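/- Let 0<q<1 and let α,β be real with α,β>−1. For every integer n≥1 and every x∈ℂ: (1−2xq^{α+1/2}+q^{2α+1})(1+2xq^{β+1/2}+q^{2β+1})·P_{n−1}^{(α+1,β+1)}(x;q) = [(1+q^{α+β+n})(1+q^{α+β+n+1})(1+q^{α+n})(1+q^{β+n})(1−q^{α+n})(1−q^{β+n})/((1−q^{2n+α+β})(1−q^{2n+α+β+1}))]·P_{n−1}^{(α,β)}(x;q) + [(1+q^{α+β+n+1})(1+q^{α+β+2n+1})(1+q^{n})²(1−q^{n})(1−q^{α−β})/((1−q^{2n+α+β})(1−q^{2n+α+β+2}))]·q^{β}·P_{n}^{(α,β)}(x;q) − [(1+q^{n})²(1+q^{n+1})²(1−q^{n})(1−q^{n+1})/((1−q^{2n+α+β+1})(1−q^{2n+α+β+2}))]·q^{α+β}·P_{n+1}^{(α,β)}(x;q). -/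

import Mathlib

open Finset Filter

/-- `rpw q t` is the complex number `q^t` (real power, `q > 0`). -/
noncomputable def rpw (q t : ℝ) : ℂ := ((q ^ t : ℝ) : ℂ)

/-- Finite q-shifted factorial `(a; qq)_n`. -/
noncomputable def qPoch (a qq : ℂ) (n : ℕ) : ℂ := ∏ j ∈ Finset.range n, (1 - a * qq ^ j)

/-- Continuous q-Jacobi polynomial `P_n^{(α,β)}(x; q)` (Rahman normalization). -/
noncomputable def qJacobi (q α β : ℝ) (n : ℕ) (x : ℂ) : ℂ :=
  (qPoch (rpw q (α + 1)) (q : ℂ) n * qPoch (-(rpw q (β + 1))) (q : ℂ) n) /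
    (qPoch (q : ℂ) (q : ℂ) n * qPoch (-(q : ℂ)) (q : ℂ) n) *
  ∑ k ∈ Finset.range (n + 1),
    (qPoch (rpw q (-(n : ℝ))) (q : ℂ) k * qPoch (rpw q ((n : ℝ) + α + β + 1)) (q : ℂ) k) /
      (qPoch (q : ℂ) (q : ℂ) k * qPoch (rpw q (α + 1)) (q : ℂ) k *
       qPoch (-(rpw q (β + 1))) (q : ℂ) k * qPoch (-(q : ℂ)) (q : ℂ) k) *
    (q : ℂ) ^ k *
    ∏ j ∈ Finset.range k, (1 - 2 * x * rpw q ((j : ℝ) + 1/2) + rpw q (2 * (j : ℝ) + 1))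

theorem shift_coeff_identity (a b q N K : ℂ) (hq : q ≠ 0) (hN : N ≠ 0) (hK : K ≠ 0)
    (h0 : 1 - a * b * N ^ 2 ≠ 0) (h1 : 1 - a * b * N ^ 2 * q ≠ 0)
    (h2 : 1 - a * b * N ^ 2 * q ^ 2 ≠ 0) :
    (1 - a / K) * (1 + b / K) * (1 - K / (q * N)) * (1 - K / N) * (1 - a * b * N * K) *
        (1 - a * b * N * q * K)
      + (a * (1 + b / K) * (1 + b * q * K) - b * (1 - a * q / K) * (1 - a * K)) / K *
        (1 - K / (q * N)) * (1 - a * b * N * K) * (1 - K ^ 2)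
      - a * b * q / K ^ 2 * (1 - K ^ 2) * (1 - K ^ 2 / q ^ 2) * (1 - a * K) * (1 + b * K)
    = (1 + a * b * N) * (1 + a * b * N * q) * (1 + a * N) * (1 - b * N) * (1 - a * b * N) *
        (1 - a * b * N * q) * (1 - K / (q * N)) * (1 - K / N) /
        ((1 - a * b * N ^ 2) * (1 - a * b * N ^ 2 * q))
      + (1 + a * b * N * q) * (1 + a * b * N ^ 2 * q) * (1 + N) * (b - a) * (1 - 1 / N) *
        (1 - a * b * N * q) * (1 - K / (q * N)) * (1 - a * b * N * K) /
        ((1 - a * b * N ^ 2) * (1 - a * b * N ^ 2 * q ^ 2))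
      - (1 + N) * (1 + N * q) * (a * b) * (1 - a * N * q) * (1 + b * N * q) * (1 - 1 / (N * q)) *
        (1 - 1 / N) * (1 - a * b * N * K) * (1 - a * b * N * q * K) /
        ((1 - a * b * N ^ 2 * q) * (1 - a * b * N ^ 2 * q ^ 2)) := by
  obtain ⟨D0, e0⟩ : ∃ D, D = 1 - a * b * N ^ 2 := ⟨_, rfl⟩
  obtain ⟨D1, e1⟩ : ∃ D, D = 1 - a * b * N ^ 2 * q := ⟨_, rfl⟩
  obtain ⟨D2, e2⟩ : ∃ D, D = 1 - a * b * N ^ 2 * q ^ 2 := ⟨_, rfl⟩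
  rw [← e0] at h0
  rw [← e1] at h1
  rw [← e2] at h2
  rw [← e0, ← e1, ← e2]
  field_simp
  rw [e0, e1, e2]
  ring

theorem qPoch_zero (a q : ℂ) : qPoch a q 0 = 1 := by simp [qPoch]

theorem qPoch_succ (a q : ℂ) (n : ℕ) : qPoch a q (n + 1) = qPoch a q n * (1 - a * q ^ n) := by
  simp [qPoch, Finset.prod_range_succ]

theorem qPoch_succ' (a q : ℂ) (n : ℕ) : qPoch a q (n + 1) = (1 - a) * qPoch (a * q) q n := by
  simp only [qPoch, Finset.prod_range_succ', pow_zero, mul_one]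
  rw [mul_comm]
  congr 1
  exact Finset.prod_congr rfl fun j _ => by ring

theorem qPoch_inv_pow_eq_zero {q : ℂ} (hq : q ≠ 0) {n k : ℕ} (h : n < k) :
    qPoch (q ^ n)⁻¹ q k = 0 :=
  Finset.prod_eq_zero (Finset.mem_range.mpr h) (by simp [hq])

/-- The prefactor of the continuous `q`-Jacobi polynomial, where `a = q ^ α`, `b = q ^ β`. -/
noncomputable def jacobiNorm (a b q : ℂ) (n : ℕ) : ℂ :=
  (qPoch (a * q) q n * qPoch (-(b * q)) q n) / (qPoch q q n * qPoch (-q) q n)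

/-- The coefficients of the terminating series, where `a = q ^ α`, `b = q ^ β`. -/
noncomputable def jacobiCoeff (a b q : ℂ) (n k : ℕ) : ℂ :=
  (qPoch (q ^ n)⁻¹ q k * qPoch (a * b * q ^ n * q) q k) /
    (qPoch q q k * qPoch (a * q) q k * qPoch (-(b * q)) q k * qPoch (-q) q k) * q ^ k

/-- The polynomial basis `∏ (1 - y q ^ j + q ^ (2 j + 1))`, where `y = 2 x q ^ (1 / 2)`. -/
noncomputable def jacobiBasis (q y : ℂ) (k : ℕ) : ℂ :=
  ∏ j ∈ Finset.range k, (1 - y * q ^ j + q * (q ^ j) ^ 2)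

theorem jacobiBasis_succ (q y : ℂ) (k : ℕ) :
    jacobiBasis q y (k + 1) = jacobiBasis q y k * (1 - y * q ^ k + q * (q ^ k) ^ 2) := by
  simp [jacobiBasis, Finset.prod_range_succ]

theorem jacobiCoeff_eq_zero {a b q : ℂ} (hq : q ≠ 0) {n k : ℕ} (h : n < k) :
    jacobiCoeff a b q n k = 0 := by
  simp [jacobiCoeff, qPoch_inv_pow_eq_zero hq h]

/-- The connection coefficients of multiplication by
`(1 - a y + a ^ 2 q) (1 + b y + b ^ 2 q)` in the basis `jacobiBasis`, at `Q = q ^ m`. -/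
noncomputable def quadCoeff₀ (a b q Q : ℂ) : ℂ :=
  (1 - a / Q) * (1 - a * q * Q) * ((1 + b / Q) * (1 + b * q * Q))

/-- The middle connection coefficient. -/
noncomputable def quadCoeff₁ (a b q Q : ℂ) : ℂ :=
  (a * (1 + b / (q * Q)) * (1 + b * q ^ 2 * Q) - b * (1 - a / Q) * (1 - a * q * Q)) / Q

/-- The top connection coefficient. -/
noncomputable def quadCoeff₂ (a b q Q : ℂ) : ℂ := -(a * b) / (q * Q ^ 2)

theorem quad_mul_jacobiBasis {a b q y : ℂ} (hq : q ≠ 0) (m : ℕ) :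
    (1 - a * y + a ^ 2 * q) * (1 + b * y + b ^ 2 * q) * jacobiBasis q y m =
      quadCoeff₀ a b q (q ^ m) * jacobiBasis q y m +
        quadCoeff₁ a b q (q ^ m) * jacobiBasis q y (m + 1) +
        quadCoeff₂ a b q (q ^ m) * jacobiBasis q y (m + 2) := by
  have hQ : q ^ m ≠ 0 := pow_ne_zero _ hq
  rw [jacobiBasis_succ q y (m + 1), jacobiBasis_succ q y m, pow_succ q m]
  generalize q ^ m = Q at *
  simp only [quadCoeff₀, quadCoeff₁, quadCoeff₂]
  field_simp
  ring

theorem sum_range_three_term {r : ℕ} (t e₀ e₁ e₂ f : ℕ → ℂ)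
    (h₁ : t (r + 1) = 0) (h₂ : t (r + 2) = 0) :
    ∑ m ∈ Finset.range (r + 1), t m * (e₀ m * f m + e₁ m * f (m + 1) + e₂ m * f (m + 2)) =
      ∑ m ∈ Finset.range (r + 1),
          (t (m + 2) * e₀ (m + 2) + t (m + 1) * e₁ (m + 1) + t m * e₂ m) * f (m + 2) +
        (t 1 * e₀ 1 + t 0 * e₁ 0) * f 1 + t 0 * e₀ 0 * f 0 := by
  have A : ∑ m ∈ Finset.range (r + 1), t m * e₀ m * f m =
      ∑ m ∈ Finset.range (r + 1), t (m + 2) * e₀ (m + 2) * f (m + 2) +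
        t 1 * e₀ 1 * f 1 + t 0 * e₀ 0 * f 0 := by
    rw [← Finset.sum_range_succ' (fun m => t (m + 1) * e₀ (m + 1) * f (m + 1)),
      ← Finset.sum_range_succ' (fun m => t m * e₀ m * f m),
      Finset.sum_range_succ _ (r + 2), Finset.sum_range_succ _ (r + 1), h₁, h₂]
    ring
  have B : ∑ m ∈ Finset.range (r + 1), t m * e₁ m * f (m + 1) =
      ∑ m ∈ Finset.range (r + 1), t (m + 1) * e₁ (m + 1) * f (m + 2) + t 0 * e₁ 0 * f 1 := by
    rw [← Finset.sum_range_succ' (fun m => t m * e₁ m * f (m + 1)),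
      Finset.sum_range_succ _ (r + 1), h₁]
    ring
  simp only [add_mul, mul_add, Finset.sum_add_distrib, ← mul_assoc]
  rw [A, B]
  ring

/-- The first coefficient on the right-hand side, at `N = q ^ n`. -/
noncomputable def shiftCoeff₁ (a b q N : ℂ) : ℂ :=
  (1 + a * b * N) * (1 + a * b * N * q) * (1 + a * N) * (1 + b * N) * (1 - a * N) * (1 - b * N) /
    ((1 - a * b * N ^ 2) * (1 - a * b * N ^ 2 * q))

/-- The second coefficient on the right-hand side, at `N = q ^ n`. -/
noncomputable def shiftCoeff₂ (a b q N : ℂ) : ℂ :=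
  (1 + a * b * N * q) * (1 + a * b * N ^ 2 * q) * (1 + N) ^ 2 * (1 - N) * (b - a) /
    ((1 - a * b * N ^ 2) * (1 - a * b * N ^ 2 * q ^ 2))

/-- The third coefficient on the right-hand side, at `N = q ^ n`. -/
noncomputable def shiftCoeff₃ (a b q N : ℂ) : ℂ :=
  (1 + N) ^ 2 * (1 + N * q) ^ 2 * (1 - N) * (1 - N * q) * (a * b) /
    ((1 - a * b * N ^ 2 * q) * (1 - a * b * N ^ 2 * q ^ 2))

theorem shift_coeff_combination {a b q N K M t₀ t₁ t₂ u₀ u₁ u₂ : ℂ}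
    (hq : q ≠ 0) (hN : N ≠ 0) (hK : K ≠ 0)
    (h0 : 1 - a * b * N ^ 2 ≠ 0) (h1 : 1 - a * b * N ^ 2 * q ≠ 0)
    (h2 : 1 - a * b * N ^ 2 * q ^ 2 ≠ 0)
    (hN1 : 1 - N ≠ 0) (hN3 : 1 - N * q ≠ 0)
    (haN : 1 - a * N ≠ 0) (hbN : 1 + b * N ≠ 0)
    (haK : 1 - a * q * K ≠ 0) (hbK : 1 + b * q * K ≠ 0)
    (ht₀ : t₀ = M * (1 - K ^ 2) * (1 - K ^ 2 / q ^ 2) * (1 - a * K) * (1 + b * K))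
    (ht₁ : t₁ = M * q * (1 - K / (q * N)) * (1 - a * b * N * K) * (1 - K ^ 2))
    (ht₂ : t₂ = M * q ^ 2 * (1 - K / (q * N)) * (1 - K / N) * (1 - a * b * N * K) *
      (1 - a * b * N * q * K) / ((1 - a * q * K) * (1 + b * q * K)))
    (hu₀ : u₀ = M * q ^ 2 * (1 - K / (q * N)) * (1 - K / N) * (1 - a * b * N) *
      (1 - a * b * N * q) / ((1 - a * N) * (1 + b * N)))
    (hu₁ : u₁ = M * q ^ 2 * (1 - 1 / N) * (1 - K / (q * N)) * (1 - a * b * N * q) *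
      (1 - a * b * N * K) / ((1 - N) * (1 + N)))
    (hu₂ : u₂ = M * q ^ 2 * (1 - 1 / N) * (1 - 1 / (N * q)) * (1 - a * b * N * K) *
      (1 - a * b * N * q * K) * (1 - a * N * q) * (1 + b * N * q) /
      ((1 - N) * (1 + N) * ((1 - N * q) * (1 + N * q)))) :
    t₂ * quadCoeff₀ a b q K + t₁ * quadCoeff₁ a b q (K / q) + t₀ * quadCoeff₂ a b q (K / q ^ 2) =
      shiftCoeff₁ a b q N * u₀ + shiftCoeff₂ a b q N * u₁ - shiftCoeff₃ a b q N * u₂ := by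
  have key := congrArg (M * q ^ 2 * ·) (shift_coeff_identity a b q N K hq hN hK h0 h1 h2)
  have e₁ : quadCoeff₁ a b q (K / q) = q * ((a * (1 + b / K) * (1 + b * q * K) -
      b * (1 - a * q / K) * (1 - a * K)) / K) := by
    rw [quadCoeff₁]
    field_simp
  have e₀ : quadCoeff₂ a b q (K / q ^ 2) = - q ^ 2 * (a * b * q / K ^ 2) := by
    rw [quadCoeff₂]
    field_simp
  rw [e₁, e₀, ht₂, ht₁, ht₀, hu₀, hu₁, hu₂, quadCoeff₀, shiftCoeff₁, shiftCoeff₂, shiftCoeff₃]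
  generalize (a * (1 + b / K) * (1 + b * q * K) - b * (1 - a * q / K) * (1 - a * K)) / K = E at *
  generalize a * b * q / K ^ 2 = F at *
  generalize 1 - K / (q * N) = X₁ at *
  generalize 1 - K / N = X₂ at *
  generalize 1 - 1 / N = X₃ at *
  generalize 1 - 1 / (N * q) = X₄ at *
  generalize 1 - K ^ 2 / q ^ 2 = X₅ at *
  generalize 1 - a / K = X₆ at *
  generalize 1 + b / K = X₇ at *
  generalize 1 - a * b * N ^ 2 * q ^ 2 = D₂ at *
  generalize 1 - a * b * N ^ 2 * q = D₁ at *
  generalize 1 - a * b * N ^ 2 = D₀ at *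
  generalize 1 - a * b * N * K = Y₁ at *
  generalize 1 - a * b * N * q * K = Y₂ at *
  generalize 1 - a * q * K = Z₁ at *
  generalize 1 + b * q * K = Z₂ at *
  generalize 1 - a * N = W₁ at *
  generalize 1 + b * N = W₂ at *
  generalize 1 - N * q = V₁ at *
  generalize 1 + N * q = V₂ at *
  generalize 1 - N = V₃ at *
  generalize 1 + N = V₄ at *
  clear e₁ e₀ ht₀ ht₁ ht₂ hu₀ hu₁ hu₂
  field_simp at key ⊢
  linear_combination key

theorem jacobiNorm_succ (a b q : ℂ) (n : ℕ) :
    jacobiNorm a b q (n + 1) = jacobiNorm a b q n *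
      ((1 - a * q ^ (n + 1)) * (1 + b * q ^ (n + 1)) /
        ((1 - q ^ (n + 1)) * (1 + q ^ (n + 1)))) := by
  simp only [jacobiNorm, qPoch_succ, div_mul_div_comm]
  congr 1 <;> ring

theorem jacobiNorm_shift {a b q : ℂ} (ha : 1 - a * q ≠ 0) (hb : 1 + b * q ≠ 0) (n : ℕ) :
    jacobiNorm (a * q) (b * q) q n = jacobiNorm a b q n *
      ((1 - a * q ^ (n + 1)) * (1 + b * q ^ (n + 1)) / ((1 - a * q) * (1 + b * q))) := by
  have hA : qPoch (a * q * q) q n = qPoch (a * q) q n * (1 - a * q ^ (n + 1)) / (1 - a * q) := by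
    rw [eq_div_iff ha, mul_comm, ← qPoch_succ', qPoch_succ]
    ring
  have hB : qPoch (-(b * q * q)) q n =
      qPoch (-(b * q)) q n * (1 + b * q ^ (n + 1)) / (1 + b * q) := by
    have e := (qPoch_succ' (-(b * q)) q n).symm.trans (qPoch_succ (-(b * q)) q n)
    rw [show -(b * q) * q = -(b * q * q) by ring] at e
    rw [eq_div_iff hb]
    linear_combination e
  rw [jacobiNorm, jacobiNorm, hA, hB]
  generalize 1 - a * q = A
  generalize 1 + b * q = B
  ring

theorem jacobiCoeff_zero (a b q : ℂ) (n : ℕ) : jacobiCoeff a b q n 0 = 1 := by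
  simp [jacobiCoeff, qPoch_zero]

theorem jacobiCoeff_succ (a b q : ℂ) (n k : ℕ) :
    jacobiCoeff a b q n (k + 1) = jacobiCoeff a b q n k *
      ((1 - q ^ k / q ^ n) * (1 - a * b * q ^ n * q ^ (k + 1)) * q /
        ((1 - q ^ (k + 1)) * (1 - a * q ^ (k + 1)) * (1 + b * q ^ (k + 1)) *
          (1 + q ^ (k + 1)))) := by
  rw [jacobiCoeff, jacobiCoeff, div_mul_eq_mul_div, div_mul_eq_mul_div, div_mul_div_comm]
  simp only [qPoch_succ]
  congr 1 <;> ring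

/-- The factor relating the denominators of `jacobiCoeff (a * q) (b * q) q _ m` and
`jacobiCoeff a b q _ (m + 2)`. -/
noncomputable def shiftDenom (a b q : ℂ) (m : ℕ) : ℂ :=
  (1 - a * q) * (1 + b * q) * ((1 - q ^ (m + 1)) * (1 + q ^ (m + 1)) *
    ((1 - q ^ (m + 2)) * (1 + q ^ (m + 2))) * (1 - a * q ^ (m + 2)) * (1 + b * q ^ (m + 2)))

theorem jacobiCoeff_denom_add_two (a b q : ℂ) (m : ℕ) :
    qPoch q q (m + 2) * qPoch (a * q) q (m + 2) * qPoch (-(b * q)) q (m + 2) *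
        qPoch (-q) q (m + 2) =
      qPoch q q m * qPoch (a * q * q) q m * qPoch (-(b * q * q)) q m * qPoch (-q) q m *
        shiftDenom a b q m := by
  rw [qPoch_succ q q, qPoch_succ q q, qPoch_succ (-q) q, qPoch_succ (-q) q,
    qPoch_succ' (a * q), qPoch_succ _ _ m, qPoch_succ' (-(b * q)), qPoch_succ _ _ m,
    show -(b * q) * q = -(b * q * q) by ring, shiftDenom]
  ring

theorem jacobiCoeff_add_two₀ (a b : ℂ) {q : ℂ} (r m : ℕ) :
    jacobiCoeff a b q r (m + 2) = jacobiCoeff (a * q) (b * q) q r m *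
      ((1 - q ^ m / q ^ r) * (1 - q ^ (m + 1) / q ^ r) * (1 - a * b * q ^ (r + 1)) *
        (1 - a * b * q ^ (r + 2)) * q ^ 2 / shiftDenom a b q m) := by
  have e : a * b * q ^ r * q * q * q = a * q * (b * q) * q ^ r * q := by ring
  rw [jacobiCoeff, jacobiCoeff, jacobiCoeff_denom_add_two, qPoch_succ, qPoch_succ _ _ m,
    qPoch_succ', qPoch_succ' _ _ m, e, div_mul_eq_mul_div, div_mul_eq_mul_div, div_mul_div_comm]
  congr 1
  ring

theorem jacobiCoeff_add_two₁ (a b : ℂ) {q : ℂ} (hq : q ≠ 0) (r m : ℕ) :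
    jacobiCoeff a b q (r + 1) (m + 2) = jacobiCoeff (a * q) (b * q) q r m *
      ((1 - 1 / q ^ (r + 1)) * (1 - q ^ m / q ^ r) * (1 - a * b * q ^ (r + 2)) *
        (1 - a * b * q ^ (r + 1) * q ^ (m + 2)) * q ^ 2 / shiftDenom a b q m) := by
  have e : a * b * q ^ (r + 1) * q * q = a * q * (b * q) * q ^ r * q := by ring
  have e' : (q ^ (r + 1))⁻¹ * q = (q ^ r)⁻¹ := by rw [pow_succ]; field_simp
  rw [jacobiCoeff, jacobiCoeff, jacobiCoeff_denom_add_two, qPoch_succ' (q ^ (r + 1))⁻¹,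
    qPoch_succ _ _ m, qPoch_succ' (a * b * q ^ (r + 1) * q), qPoch_succ _ _ m, e, e',
    div_mul_eq_mul_div, div_mul_eq_mul_div, div_mul_div_comm]
  congr 1
  ring

theorem jacobiCoeff_add_two₂ (a b : ℂ) {q : ℂ} (hq : q ≠ 0) (r m : ℕ) :
    jacobiCoeff a b q (r + 2) (m + 2) = jacobiCoeff (a * q) (b * q) q r m *
      ((1 - 1 / q ^ (r + 1)) * (1 - 1 / q ^ (r + 2)) * (1 - a * b * q ^ (r + 1) * q ^ (m + 2)) *
        (1 - a * b * q ^ (r + 2) * q ^ (m + 2)) * q ^ 2 / shiftDenom a b q m) := by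
  have e : a * b * q ^ (r + 2) * q = a * q * (b * q) * q ^ r * q := by ring
  have e' : (q ^ (r + 2))⁻¹ * q = (q ^ (r + 1))⁻¹ := by rw [pow_succ q (r + 1)]; field_simp
  have e'' : (q ^ (r + 1))⁻¹ * q = (q ^ r)⁻¹ := by rw [pow_succ]; field_simp
  rw [jacobiCoeff, jacobiCoeff, jacobiCoeff_denom_add_two, qPoch_succ' (q ^ (r + 2))⁻¹, e',
    qPoch_succ' (q ^ (r + 1))⁻¹, e'', qPoch_succ (a * b * q ^ (r + 2) * q), qPoch_succ _ _ m, e,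
    div_mul_eq_mul_div, div_mul_eq_mul_div, div_mul_div_comm]
  congr 1
  ring

/-- The termwise form of the connection formula. -/
theorem jacobi_combination_add_two {a b q : ℂ} (hq : q ≠ 0)
    (hqm : ∀ k : ℕ, 1 - q ^ (k + 1) ≠ 0) (hqp : ∀ k : ℕ, 1 + q ^ (k + 1) ≠ 0)
    (ha : ∀ k : ℕ, 1 - a * q ^ (k + 1) ≠ 0) (hb : ∀ k : ℕ, 1 + b * q ^ (k + 1) ≠ 0) (r m : ℕ)
    (h0 : 1 - a * b * (q ^ (r + 1)) ^ 2 ≠ 0) (h1 : 1 - a * b * (q ^ (r + 1)) ^ 2 * q ≠ 0)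
    (h2 : 1 - a * b * (q ^ (r + 1)) ^ 2 * q ^ 2 ≠ 0) :
    jacobiNorm (a * q) (b * q) q r * jacobiCoeff (a * q) (b * q) q r (m + 2) *
          quadCoeff₀ a b q (q ^ (m + 2)) +
        jacobiNorm (a * q) (b * q) q r * jacobiCoeff (a * q) (b * q) q r (m + 1) *
          quadCoeff₁ a b q (q ^ (m + 1)) +
        jacobiNorm (a * q) (b * q) q r * jacobiCoeff (a * q) (b * q) q r m *
          quadCoeff₂ a b q (q ^ m) =
      shiftCoeff₁ a b q (q ^ (r + 1)) * (jacobiNorm a b q r * jacobiCoeff a b q r (m + 2)) +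
        shiftCoeff₂ a b q (q ^ (r + 1)) *
          (jacobiNorm a b q (r + 1) * jacobiCoeff a b q (r + 1) (m + 2)) -
        shiftCoeff₃ a b q (q ^ (r + 1)) *
          (jacobiNorm a b q (r + 2) * jacobiCoeff a b q (r + 2) (m + 2)) := by
  have ha' := ha 0
  have hb' := hb 0
  rw [zero_add, pow_one] at ha' hb'
  have haK : 1 - a * q * q ^ (m + 2) ≠ 0 := by
    have := ha (m + 2)
    rwa [pow_succ', ← mul_assoc] at this
  have hbK : 1 + b * q * q ^ (m + 2) ≠ 0 := by
    have := hb (m + 2)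
    rwa [pow_succ', ← mul_assoc] at this
  have hN3 : 1 - q ^ (r + 1) * q ≠ 0 := by
    rw [← pow_succ]
    exact hqm (r + 1)
  have eK₁ : q ^ (m + 1) = q ^ (m + 2) / q := by rw [pow_succ q (m + 1)]; field_simp
  have eK₀ : q ^ m = q ^ (m + 2) / q ^ 2 := by rw [pow_add q m 2]; field_simp
  have eKN : q ^ (m + 2) / (q * q ^ (r + 1)) = q ^ m / q ^ r := by
    rw [pow_add q m 2, pow_succ q r]
    field_simp
  have eKN' : q ^ (m + 2) / q ^ (r + 1) = q ^ (m + 1) / q ^ r := by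
    rw [pow_succ q (m + 1), pow_succ q r, mul_div_mul_right _ _ hq]
  have eKq : (q ^ (m + 2)) ^ 2 / q ^ 2 = (q ^ (m + 1)) ^ 2 := by rw [eK₁, div_pow]
  have eN : q ^ (r + 1) * q = q ^ (r + 2) := (pow_succ q (r + 1)).symm
  have eK : q * q ^ (m + 2) = q ^ (m + 3) := (pow_succ' q (m + 2)).symm
  have sq_fac : ∀ z : ℂ, 1 - z ^ 2 = (1 - z) * (1 + z) := fun z => by ring
  have hR : q ^ r ≠ 0 := pow_ne_zero r hq
  have c₁ := hqm m
  have c₂ := hqp m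
  have c₃ : 1 - q ^ (m + 2) ≠ 0 := hqm (m + 1)
  have c₄ : 1 + q ^ (m + 2) ≠ 0 := hqp (m + 1)
  have c₅ : 1 - a * q ^ (m + 2) ≠ 0 := ha (m + 1)
  have c₆ : 1 + b * q ^ (m + 2) ≠ 0 := hb (m + 1)
  have c₇ := hqm r
  have c₈ := hqp r
  have c₉ : 1 - q ^ (r + 2) ≠ 0 := hqm (r + 1)
  have c₁₀ : 1 + q ^ (r + 2) ≠ 0 := hqp (r + 1)
  have c₁₁ := ha r
  have c₁₂ := hb r
  nth_rw 1 [eK₁, eK₀]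
  refine shift_coeff_combination
    (M := jacobiNorm (a * q) (b * q) q r * jacobiCoeff (a * q) (b * q) q r m /
      ((1 - q ^ (m + 1)) * (1 + q ^ (m + 1)) *
        ((1 - q ^ (m + 2)) * (1 + q ^ (m + 2))) * (1 - a * q ^ (m + 2)) * (1 + b * q ^ (m + 2))))
    hq (pow_ne_zero _ hq) (pow_ne_zero _ hq) h0 h1 h2 (hqm r) hN3 (ha r) (hb r) haK hbK
    ?_ ?_ ?_ ?_ ?_ ?_
  · rw [sq_fac, eKq, sq_fac]
    field_simp
  · rw [jacobiCoeff_succ, eKN, sq_fac,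
      show a * q * (b * q) * q ^ r * q ^ (m + 1) = a * b * q ^ (r + 1) * q ^ (m + 2) by ring,
      show a * q * q ^ (m + 1) = a * q ^ (m + 2) by ring,
      show b * q * q ^ (m + 1) = b * q ^ (m + 2) by ring]
    generalize 1 - q ^ (m + 1) = x₁ at *
    generalize 1 + q ^ (m + 1) = x₂ at *
    generalize 1 - q ^ (m + 2) = x₃ at *
    generalize 1 + q ^ (m + 2) = x₄ at *
    generalize 1 - a * q ^ (m + 2) = x₅ at *
    generalize 1 + b * q ^ (m + 2) = x₆ at *
    generalize 1 - q ^ m / q ^ r = x₇ at *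
    generalize 1 - a * b * q ^ (r + 1) * q ^ (m + 2) = x₈ at *
    field_simp
  · rw [jacobiCoeff_succ, jacobiCoeff_succ, eKN, eKN',
      show a * q * (b * q) * q ^ r * q ^ (m + 1) = a * b * q ^ (r + 1) * q ^ (m + 2) by ring,
      show a * q * (b * q) * q ^ r * q ^ (m + 1 + 1) =
        a * b * q ^ (r + 1) * q * q ^ (m + 2) by ring,
      show a * q * q ^ (m + 1) = a * q ^ (m + 2) by ring,
      show b * q * q ^ (m + 1) = b * q ^ (m + 2) by ring,
      show m + 1 + 1 = m + 2 from rfl]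
    generalize 1 - q ^ (m + 1) = x₁ at *
    generalize 1 + q ^ (m + 1) = x₂ at *
    generalize 1 - q ^ (m + 2) = x₃ at *
    generalize 1 + q ^ (m + 2) = x₄ at *
    generalize 1 - a * q ^ (m + 2) = x₅ at *
    generalize 1 + b * q ^ (m + 2) = x₆ at *
    generalize 1 - q ^ m / q ^ r = x₇ at *
    generalize 1 - q ^ (m + 1) / q ^ r = x₉ at *
    generalize 1 - a * b * q ^ (r + 1) * q ^ (m + 2) = x₈ at *
    generalize 1 - a * b * q ^ (r + 1) * q * q ^ (m + 2) = x₁₀ at *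
    generalize 1 - a * q * q ^ (m + 2) = x₁₁ at *
    generalize 1 + b * q * q ^ (m + 2) = x₁₂ at *
    field_simp
  · rw [jacobiCoeff_add_two₀, jacobiNorm_shift ha' hb', shiftDenom, eKN, eKN', mul_assoc (a * b),
      eN]
    generalize 1 - q ^ (m + 1) = x₁ at *
    generalize 1 + q ^ (m + 1) = x₂ at *
    generalize 1 - q ^ (m + 2) = x₃ at *
    generalize 1 + q ^ (m + 2) = x₄ at *
    generalize 1 - a * q ^ (m + 2) = x₅ at *
    generalize 1 + b * q ^ (m + 2) = x₆ at *
    generalize 1 - q ^ m / q ^ r = x₇ at *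
    generalize 1 - q ^ (m + 1) / q ^ r = x₉ at *
    generalize 1 - a * q ^ (r + 1) = y₁ at *
    generalize 1 + b * q ^ (r + 1) = y₂ at *
    generalize 1 - a * q = y₃ at *
    generalize 1 + b * q = y₄ at *
    field_simp
  · rw [jacobiCoeff_add_two₁ a b hq, jacobiNorm_shift ha' hb', jacobiNorm_succ, shiftDenom, eKN,
      mul_assoc (a * b) _ q, eN]
    generalize 1 - q ^ (m + 1) = x₁ at *
    generalize 1 + q ^ (m + 1) = x₂ at *
    generalize 1 - q ^ (m + 2) = x₃ at *
    generalize 1 + q ^ (m + 2) = x₄ at *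
    generalize 1 - a * q ^ (m + 2) = x₅ at *
    generalize 1 + b * q ^ (m + 2) = x₆ at *
    generalize 1 - q ^ m / q ^ r = x₇ at *
    generalize 1 - q ^ (r + 1) = z₁ at *
    generalize 1 + q ^ (r + 1) = z₂ at *
    generalize 1 - a * q ^ (r + 1) = y₁ at *
    generalize 1 + b * q ^ (r + 1) = y₂ at *
    generalize 1 - a * q = y₃ at *
    generalize 1 + b * q = y₄ at *
    field_simp
  · rw [jacobiCoeff_add_two₂ a b hq, jacobiNorm_shift ha' hb', jacobiNorm_succ, jacobiNorm_succ,
      shiftDenom, mul_assoc (a * b) _ q, mul_assoc a _ q, mul_assoc b _ q, eN]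
    generalize 1 - q ^ (m + 1) = x₁ at *
    generalize 1 + q ^ (m + 1) = x₂ at *
    generalize 1 - q ^ (m + 2) = x₃ at *
    generalize 1 + q ^ (m + 2) = x₄ at *
    generalize 1 - a * q ^ (m + 2) = x₅ at *
    generalize 1 + b * q ^ (m + 2) = x₆ at *
    generalize 1 - 1 / q ^ (r + 1) = z₅ at *
    generalize 1 - 1 / q ^ (r + 2) = z₆ at *
    generalize 1 - q ^ (r + 1) = z₁ at *
    generalize 1 + q ^ (r + 1) = z₂ at *
    generalize 1 - q ^ (r + 2) = z₃ at *
    generalize 1 + q ^ (r + 2) = z₄ at *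
    generalize 1 - a * q ^ (r + 1) = y₁ at *
    generalize 1 + b * q ^ (r + 1) = y₂ at *
    generalize 1 - a * q = y₃ at *
    generalize 1 + b * q = y₄ at *
    field_simp

theorem jacobi_combination_zero {a b q : ℂ}
    (hqm : ∀ k : ℕ, 1 - q ^ (k + 1) ≠ 0) (hqp : ∀ k : ℕ, 1 + q ^ (k + 1) ≠ 0)
    (ha : 1 - a * q ≠ 0) (hb : 1 + b * q ≠ 0) (r : ℕ)
    (h0 : 1 - a * b * (q ^ (r + 1)) ^ 2 ≠ 0) (h1 : 1 - a * b * (q ^ (r + 1)) ^ 2 * q ≠ 0)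
    (h2 : 1 - a * b * (q ^ (r + 1)) ^ 2 * q ^ 2 ≠ 0) :
    jacobiNorm (a * q) (b * q) q r * quadCoeff₀ a b q 1 =
      shiftCoeff₁ a b q (q ^ (r + 1)) * jacobiNorm a b q r +
        shiftCoeff₂ a b q (q ^ (r + 1)) * jacobiNorm a b q (r + 1) -
        shiftCoeff₃ a b q (q ^ (r + 1)) * jacobiNorm a b q (r + 2) := by
  have hN₁ := hqm r
  have hN₂ := hqp r
  have hN₃ := hqm (r + 1)
  have hN₄ := hqp (r + 1)
  rw [jacobiNorm_shift ha hb, jacobiNorm_succ a b q (r + 1), jacobiNorm_succ a b q r]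
  rw [pow_succ q (r + 1)] at hN₃ hN₄ ⊢
  generalize q ^ (r + 1) = N at *
  generalize jacobiNorm a b q r = S
  have key : (1 - a) * (1 + b) =
      (1 + a * b * N) * (1 + a * b * N * q) * (1 + a * N) * (1 - b * N) /
          ((1 - a * b * N ^ 2) * (1 - a * b * N ^ 2 * q)) +
        (1 + a * b * N * q) * (1 + a * b * N ^ 2 * q) * (1 + N) * (b - a) /
          ((1 - a * b * N ^ 2) * (1 - a * b * N ^ 2 * q ^ 2)) -
        (1 + N) * (1 + N * q) * (a * b) * (1 - a * (N * q)) * (1 + b * (N * q)) /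
          ((1 - a * b * N ^ 2 * q) * (1 - a * b * N ^ 2 * q ^ 2)) := by
    obtain ⟨D₀, e₀⟩ : ∃ D, D = 1 - a * b * N ^ 2 := ⟨_, rfl⟩
    obtain ⟨D₁, e₁⟩ : ∃ D, D = 1 - a * b * N ^ 2 * q := ⟨_, rfl⟩
    obtain ⟨D₂, e₂⟩ : ∃ D, D = 1 - a * b * N ^ 2 * q ^ 2 := ⟨_, rfl⟩
    rw [← e₀] at h0
    rw [← e₁] at h1
    rw [← e₂] at h2
    rw [← e₀, ← e₁, ← e₂]
    field_simp
    rw [e₀, e₁, e₂]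
    ring
  have e : quadCoeff₀ a b q 1 = (1 - a) * (1 + b) * ((1 - a * q) * (1 + b * q)) := by
    simp only [quadCoeff₀, div_one, mul_one]
    ring
  rw [e, key, shiftCoeff₁, shiftCoeff₂, shiftCoeff₃]
  clear key e
  generalize 1 - a * b * N ^ 2 * q ^ 2 = D₂ at *
  generalize 1 - a * b * N ^ 2 * q = D₁ at *
  generalize 1 - a * b * N ^ 2 = D₀ at *
  generalize 1 - a * q = A at *
  generalize 1 + b * q = B at *
  generalize 1 - N * q = V₁ at *
  generalize 1 + N * q = V₂ at *
  generalize 1 - N = V₃ at *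
  generalize 1 + N = V₄ at *
  field_simp

theorem jacobi_combination_one {a b q : ℂ} (hq : q ≠ 0)
    (hqm : ∀ k : ℕ, 1 - q ^ (k + 1) ≠ 0) (hqp : ∀ k : ℕ, 1 + q ^ (k + 1) ≠ 0)
    (ha : ∀ k : ℕ, 1 - a * q ^ (k + 1) ≠ 0) (hb : ∀ k : ℕ, 1 + b * q ^ (k + 1) ≠ 0) (r : ℕ)
    (h0 : 1 - a * b * (q ^ (r + 1)) ^ 2 ≠ 0) (h1 : 1 - a * b * (q ^ (r + 1)) ^ 2 * q ≠ 0)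
    (h2 : 1 - a * b * (q ^ (r + 1)) ^ 2 * q ^ 2 ≠ 0) (h3 : 1 - a * b * q ^ (r + 1) * q ≠ 0) :
    jacobiNorm (a * q) (b * q) q r * jacobiCoeff (a * q) (b * q) q r 1 * quadCoeff₀ a b q q +
        jacobiNorm (a * q) (b * q) q r * quadCoeff₁ a b q 1 =
      shiftCoeff₁ a b q (q ^ (r + 1)) * (jacobiNorm a b q r * jacobiCoeff a b q r 1) +
        shiftCoeff₂ a b q (q ^ (r + 1)) *
          (jacobiNorm a b q (r + 1) * jacobiCoeff a b q (r + 1) 1) -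
        shiftCoeff₃ a b q (q ^ (r + 1)) *
          (jacobiNorm a b q (r + 2) * jacobiCoeff a b q (r + 2) 1) := by
  have ha₁ := ha 0
  have hb₁ := hb 0
  have ha₂ := ha 1
  have hb₂ := hb 1
  have hq₁ := hqm 0
  have hq₂ := hqp 0
  have hN₁ := hqm r
  have hN₂ := hqp r
  have hN₃ := hqm (r + 1)
  have hN₄ := hqp (r + 1)
  have haN := ha r
  have hbN := hb r
  have hq₃ : 1 - q ^ 2 ≠ 0 := hqm 1
  have hN : q ^ (r + 1) ≠ 0 := pow_ne_zero _ hq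
  have hX : 1 - 1 / q ^ (r + 1) ≠ 0 := by
    rw [one_sub_div hN, div_ne_zero_iff, ← neg_ne_zero, neg_sub]
    exact ⟨hN₁, hN⟩
  have hR : q ^ r = q ^ (r + 1) / q := by rw [pow_succ, mul_div_cancel_right₀ _ hq]
  have hqN : q / (q * q ^ (r + 1)) = 1 / q ^ (r + 1) := by field_simp
  simp only [zero_add, pow_one, Nat.reduceAdd] at ha₁ hb₁ ha₂ hb₂ hq₁ hq₂
  rw [pow_succ q (r + 1)] at hN₃ hN₄
  rw [pow_two, ← mul_assoc] at ha₂ hb₂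
  have main := shift_coeff_combination (a := a) (b := b) (q := q) (N := q ^ (r + 1)) (K := q)
    (M := jacobiNorm (a * q) (b * q) q r /
      (q * (1 - 1 / q ^ (r + 1)) * (1 - a * b * q ^ (r + 1) * q) * (1 - q ^ 2)))
    (t₀ := 0) (t₁ := jacobiNorm (a * q) (b * q) q r)
    (t₂ := jacobiNorm (a * q) (b * q) q r * jacobiCoeff (a * q) (b * q) q r 1)
    (u₀ := jacobiNorm a b q r * jacobiCoeff a b q r 1)
    (u₁ := jacobiNorm a b q (r + 1) * jacobiCoeff a b q (r + 1) 1)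
    (u₂ := jacobiNorm a b q (r + 2) * jacobiCoeff a b q (r + 2) 1)
    hq hN hq h0 h1 h2 hN₁ hN₃ haN hbN ha₂ hb₂
  rw [zero_mul, add_zero, div_self hq] at main
  have sq_fac : 1 - q ^ 2 = (1 - q) * (1 + q) := by ring
  apply main <;> clear main
  · rw [div_self (pow_ne_zero 2 hq), sub_self]
    ring
  · rw [hqN]
    generalize 1 - 1 / q ^ (r + 1) = X at *
    generalize 1 - a * b * q ^ (r + 1) * q = Y at *
    generalize 1 - q ^ 2 = Z at *
    field_simp
  · rw [jacobiCoeff_succ, jacobiCoeff_zero, zero_add, pow_zero, pow_one, hqN,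
      show 1 / q ^ r = q / q ^ (r + 1) by rw [hR]; field_simp,
      show a * q * (b * q) * q ^ r * q = a * b * q ^ (r + 1) * q * q by ring, sq_fac]
    generalize 1 - 1 / q ^ (r + 1) = X at *
    generalize 1 - q / q ^ (r + 1) = X₁ at *
    generalize 1 - a * b * q ^ (r + 1) * q * q = Y₁ at *
    generalize 1 - a * b * q ^ (r + 1) * q = Y at *
    generalize 1 - a * q * q = Z₁ at *
    generalize 1 + b * q * q = Z₂ at *
    generalize 1 - q = Z₃ at *
    generalize 1 + q = Z₄ at *
    field_simp
  · rw [jacobiNorm_shift ha₁ hb₁, jacobiCoeff_succ, jacobiCoeff_zero, zero_add, pow_zero, pow_one,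
      hqN, show 1 / q ^ r = q / q ^ (r + 1) by rw [hR]; field_simp,
      show a * b * q ^ r * q = a * b * q ^ (r + 1) by ring, sq_fac]
    generalize 1 - 1 / q ^ (r + 1) = X at *
    generalize 1 - q / q ^ (r + 1) = X₁ at *
    generalize 1 - a * b * q ^ (r + 1) * q = Y at *
    generalize 1 - a * q ^ (r + 1) = W₁ at *
    generalize 1 + b * q ^ (r + 1) = W₂ at *
    generalize 1 - a * q = Z₁ at *
    generalize 1 + b * q = Z₂ at *
    generalize 1 - q = Z₃ at *
    generalize 1 + q = Z₄ at *
    field_simp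
  · rw [jacobiNorm_shift ha₁ hb₁, jacobiNorm_succ, jacobiCoeff_succ, jacobiCoeff_zero, zero_add,
      pow_zero, pow_one, hqN, sq_fac]
    generalize 1 - 1 / q ^ (r + 1) = X at *
    generalize 1 - a * b * q ^ (r + 1) * q = Y at *
    generalize 1 - a * q ^ (r + 1) = W₁ at *
    generalize 1 + b * q ^ (r + 1) = W₂ at *
    generalize 1 - q ^ (r + 1) = V₁ at *
    generalize 1 + q ^ (r + 1) = V₂ at *
    generalize 1 - a * q = Z₁ at *
    generalize 1 + b * q = Z₂ at *
    generalize 1 - q = Z₃ at *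
    generalize 1 + q = Z₄ at *
    field_simp
  · have hr2 : q ^ (r + 2) = q ^ (r + 1) * q := pow_succ q (r + 1)
    rw [jacobiNorm_shift ha₁ hb₁, jacobiNorm_succ a b q (r + 1), jacobiNorm_succ a b q r,
      jacobiCoeff_succ, jacobiCoeff_zero, zero_add, pow_zero, pow_one, sq_fac, hr2,
      mul_assoc a _ q, mul_assoc b _ q, ← mul_assoc (a * b)]
    generalize 1 - 1 / q ^ (r + 1) = X at *
    generalize 1 - 1 / (q ^ (r + 1) * q) = X₁ at *
    generalize 1 - a * b * q ^ (r + 1) * q * q = Y₁ at *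
    generalize 1 - a * b * q ^ (r + 1) * q = Y at *
    generalize 1 - a * (q ^ (r + 1) * q) = U₁ at *
    generalize 1 + b * (q ^ (r + 1) * q) = U₂ at *
    generalize 1 - a * q ^ (r + 1) = W₁ at *
    generalize 1 + b * q ^ (r + 1) = W₂ at *
    generalize 1 - q ^ (r + 1) * q = V₃ at *
    generalize 1 + q ^ (r + 1) * q = V₄ at *
    generalize 1 - q ^ (r + 1) = V₁ at *
    generalize 1 + q ^ (r + 1) = V₂ at *
    generalize 1 - a * q = Z₁ at *
    generalize 1 + b * q = Z₂ at *
    generalize 1 - q = Z₃ at *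
    generalize 1 + q = Z₄ at *
    field_simp

/-- The continuous `q`-Jacobi polynomial, where `a = q ^ α`, `b = q ^ β`,
`y = 2 x q ^ (1 / 2)`. -/
noncomputable def jacobiPoly (a b q : ℂ) (n : ℕ) (y : ℂ) : ℂ :=
  jacobiNorm a b q n *
    ∑ k ∈ Finset.range (n + 1), jacobiCoeff a b q n k * jacobiBasis q y k

theorem jacobiPoly_eq_sum_range {a b q : ℂ} (hq : q ≠ 0) {n l : ℕ} (h : n + 1 ≤ l) (y : ℂ) :
    jacobiPoly a b q n y =
      ∑ k ∈ Finset.range l, jacobiNorm a b q n * jacobiCoeff a b q n k * jacobiBasis q y k := by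
  rw [jacobiPoly, Finset.mul_sum]
  simp only [← mul_assoc]
  refine Finset.sum_subset (Finset.range_subset_range.mpr h) fun k _ hk => ?_
  rw [jacobiCoeff_eq_zero hq (by simpa [Nat.succ_le_iff] using hk), mul_zero, zero_mul]

theorem quad_mul_jacobiPoly {a b q : ℂ} (hq : q ≠ 0)
    (hqm : ∀ k : ℕ, 1 - q ^ (k + 1) ≠ 0) (hqp : ∀ k : ℕ, 1 + q ^ (k + 1) ≠ 0)
    (ha : ∀ k : ℕ, 1 - a * q ^ (k + 1) ≠ 0) (hb : ∀ k : ℕ, 1 + b * q ^ (k + 1) ≠ 0) (r : ℕ)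
    (h0 : 1 - a * b * (q ^ (r + 1)) ^ 2 ≠ 0) (h1 : 1 - a * b * (q ^ (r + 1)) ^ 2 * q ≠ 0)
    (h2 : 1 - a * b * (q ^ (r + 1)) ^ 2 * q ^ 2 ≠ 0) (h3 : 1 - a * b * q ^ (r + 1) * q ≠ 0)
    (y : ℂ) :
    (1 - a * y + a ^ 2 * q) * (1 + b * y + b ^ 2 * q) * jacobiPoly (a * q) (b * q) q r y =
      shiftCoeff₁ a b q (q ^ (r + 1)) * jacobiPoly a b q r y +
        shiftCoeff₂ a b q (q ^ (r + 1)) * jacobiPoly a b q (r + 1) y -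
        shiftCoeff₃ a b q (q ^ (r + 1)) * jacobiPoly a b q (r + 2) y := by
  rw [jacobiPoly_eq_sum_range hq le_rfl, jacobiPoly_eq_sum_range (l := r + 3) hq (by omega),
    jacobiPoly_eq_sum_range (l := r + 3) hq (by omega),
    jacobiPoly_eq_sum_range (l := r + 3) hq (by omega)]
  have hL : (1 - a * y + a ^ 2 * q) * (1 + b * y + b ^ 2 * q) *
      ∑ k ∈ Finset.range (r + 1), jacobiNorm (a * q) (b * q) q r *
        jacobiCoeff (a * q) (b * q) q r k * jacobiBasis q y k =
      ∑ m ∈ Finset.range (r + 1), jacobiNorm (a * q) (b * q) q r *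
        jacobiCoeff (a * q) (b * q) q r m *
        (quadCoeff₀ a b q (q ^ m) * jacobiBasis q y m +
          quadCoeff₁ a b q (q ^ m) * jacobiBasis q y (m + 1) +
          quadCoeff₂ a b q (q ^ m) * jacobiBasis q y (m + 2)) := by
    rw [Finset.mul_sum]
    refine Finset.sum_congr rfl fun m _ => ?_
    rw [← quad_mul_jacobiBasis hq]
    ring
  rw [hL, sum_range_three_term
    (fun m => jacobiNorm (a * q) (b * q) q r * jacobiCoeff (a * q) (b * q) q r m)
    (fun m => quadCoeff₀ a b q (q ^ m)) (fun m => quadCoeff₁ a b q (q ^ m))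
    (fun m => quadCoeff₂ a b q (q ^ m)) (jacobiBasis q y)
    (by rw [jacobiCoeff_eq_zero hq (by omega), mul_zero])
    (by rw [jacobiCoeff_eq_zero hq (by omega), mul_zero])]
  simp only [Finset.sum_range_succ' _ (r + 2), Finset.sum_range_succ' _ (r + 1), zero_add,
    jacobiCoeff_zero, mul_one, pow_zero, pow_one,
    jacobi_combination_add_two hq hqm hqp ha hb r _ h0 h1 h2,
    jacobi_combination_one hq hqm hqp ha hb r h0 h1 h2 h3,
    jacobi_combination_zero hqm hqp (by simpa using ha 0) (by simpa using hb 0) r h0 h1 h2]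
  simp only [add_mul, sub_mul, mul_add, Finset.sum_add_distrib, Finset.sum_sub_distrib,
    Finset.mul_sum, mul_assoc, add_assoc, Nat.reduceAdd]
  ring

theorem rpw_add {q : ℝ} (hq : 0 < q) (s t : ℝ) : rpw q (s + t) = rpw q s * rpw q t := by
  simp [rpw, Real.rpow_add hq]

theorem rpw_natCast (q : ℝ) (n : ℕ) : rpw q n = (q : ℂ) ^ n := by
  simp [rpw, Real.rpow_natCast]

theorem rpw_one (q : ℝ) : rpw q 1 = (q : ℂ) := by simp [rpw]

theorem rpw_nat_mul {q : ℝ} (hq : 0 < q) (n : ℕ) (t : ℝ) : rpw q (n * t) = rpw q t ^ n := by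
  simp only [rpw]
  rw [mul_comm, Real.rpow_mul hq.le, Real.rpow_natCast, Complex.ofReal_pow]

theorem rpw_two_mul {q : ℝ} (hq : 0 < q) (t : ℝ) : rpw q (2 * t) = rpw q t ^ 2 := by
  exact_mod_cast rpw_nat_mul hq 2 t

theorem rpw_neg {q : ℝ} (hq : 0 < q) (t : ℝ) : rpw q (-t) = (rpw q t)⁻¹ := by
  simp [rpw, Real.rpow_neg hq.le]

theorem one_sub_rpw_ne_zero {q t : ℝ} (hq0 : 0 < q) (hq1 : q < 1) (ht : 0 < t) :
    1 - rpw q t ≠ 0 := by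
  have := Real.rpow_lt_one hq0.le hq1 ht
  rw [rpw]
  exact_mod_cast (sub_pos.mpr this).ne'

theorem one_add_rpw_ne_zero {q : ℝ} (hq : 0 < q) (t : ℝ) : 1 + rpw q t ≠ 0 := by
  have := Real.rpow_pos_of_pos hq t
  rw [rpw]
  exact_mod_cast (add_pos one_pos this).ne'

theorem qJacobi_eq_jacobiPoly {q : ℝ} (hq : 0 < q) (α β : ℝ) (n : ℕ) (x : ℂ) :
    qJacobi q α β n x =
      jacobiPoly (rpw q α) (rpw q β) q n (2 * x * rpw q (1 / 2)) := by
  have hbasis : ∀ k, ∏ j ∈ Finset.range k,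
      (1 - 2 * x * rpw q ((j : ℝ) + 1/2) + rpw q (2 * (j : ℝ) + 1)) =
      jacobiBasis q (2 * x * rpw q (1 / 2)) k := fun k =>
    Finset.prod_congr rfl fun j _ => by
      rw [rpw_add hq, rpw_add hq, rpw_two_mul hq, rpw_natCast, rpw_one]
      ring
  have e : rpw q ((n : ℝ) + α + β + 1) = rpw q α * rpw q β * (q : ℂ) ^ n * q := by
    rw [rpw_add hq, rpw_add hq, rpw_add hq, rpw_natCast, rpw_one]
    ring
  rw [qJacobi, jacobiPoly, jacobiNorm]
  simp only [hbasis, e]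
  simp only [jacobiCoeff, rpw_neg hq, rpw_natCast, rpw_add hq _ 1, rpw_one]

theorem statement0 (q α β : ℝ) (hq0 : 0 < q) (hq1 : q < 1)
    (hα : -1 < α) (hβ : -1 < β) (n : ℕ) (hn : 1 ≤ n) (x : ℂ) :
    (1 - 2 * x * rpw q (α + 1/2) + rpw q (2 * α + 1)) *
      (1 + 2 * x * rpw q (β + 1/2) + rpw q (2 * β + 1)) *
      qJacobi q (α + 1) (β + 1) (n - 1) x =
    ((1 + rpw q (α + β + (n : ℝ))) * (1 + rpw q (α + β + (n : ℝ) + 1)) *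
       (1 + rpw q (α + (n : ℝ))) * (1 + rpw q (β + (n : ℝ))) *
       (1 - rpw q (α + (n : ℝ))) * (1 - rpw q (β + (n : ℝ))) /
       ((1 - rpw q (2 * (n : ℝ) + α + β)) * (1 - rpw q (2 * (n : ℝ) + α + β + 1)))) *
      qJacobi q α β (n - 1) x
    + ((1 + rpw q (α + β + (n : ℝ) + 1)) * (1 + rpw q (α + β + 2 * (n : ℝ) + 1)) *
       (1 + rpw q (n : ℝ)) ^ 2 * (1 - rpw q (n : ℝ)) * (1 - rpw q (α - β)) /
       ((1 - rpw q (2 * (n : ℝ) + α + β)) * (1 - rpw q (2 * (n : ℝ) + α + β + 2)))) *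
      rpw q β * qJacobi q α β n x
    - ((1 + rpw q (n : ℝ)) ^ 2 * (1 + rpw q ((n : ℝ) + 1)) ^ 2 *
       (1 - rpw q (n : ℝ)) * (1 - rpw q ((n : ℝ) + 1)) /
       ((1 - rpw q (2 * (n : ℝ) + α + β + 1)) * (1 - rpw q (2 * (n : ℝ) + α + β + 2)))) *
      rpw q (α + β) * qJacobi q α β (n + 1) x := by
  obtain ⟨r, rfl⟩ : ∃ r, n = r + 1 := ⟨n - 1, by omega⟩
  have hr : (0 : ℝ) ≤ r := Nat.cast_nonneg r
  have hqc : (q : ℂ) ≠ 0 := by exact_mod_cast hq0.ne'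
  have hrN : rpw q ((r + 1 : ℕ) : ℝ) = (q : ℂ) ^ (r + 1) := rpw_natCast q (r + 1)
  have hpow : ∀ k : ℕ, (q : ℂ) ^ (k + 1) = rpw q ((k : ℝ) + 1) := fun k => by
    exact_mod_cast (rpw_natCast q (k + 1)).symm
  have hsub : rpw q (α - β) = rpw q α / rpw q β := by
    rw [sub_eq_add_neg, rpw_add hq0, rpw_neg hq0, div_eq_mul_inv]
  have hβ0 : rpw q β ≠ 0 := by
    rw [rpw]
    exact_mod_cast (Real.rpow_pos_of_pos hq0 β).ne'
  have hN2 : ((q : ℂ) ^ (r + 1)) ^ 2 = rpw q (2 * ((r : ℝ) + 1)) := by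
    rw [hpow, rpw_two_mul hq0]
  have h := quad_mul_jacobiPoly (a := rpw q α) (b := rpw q β) hqc
    (fun k => by rw [hpow]; exact one_sub_rpw_ne_zero hq0 hq1 (by positivity))
    (fun k => by rw [hpow]; exact one_add_rpw_ne_zero hq0 _)
    (fun k => by
      rw [hpow, ← rpw_add hq0]
      exact one_sub_rpw_ne_zero hq0 hq1 (by linarith [(Nat.cast_nonneg k : (0 : ℝ) ≤ k)]))
    (fun k => by rw [hpow, ← rpw_add hq0]; exact one_add_rpw_ne_zero hq0 _) r
    (by
      rw [hN2, ← rpw_add hq0, ← rpw_add hq0]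
      exact one_sub_rpw_ne_zero hq0 hq1 (by linarith))
    (by
      rw [hN2, ← rpw_one q, ← rpw_add hq0, ← rpw_add hq0, ← rpw_add hq0]
      exact one_sub_rpw_ne_zero hq0 hq1 (by linarith))
    (by
      rw [hN2, ← rpw_one q, ← rpw_two_mul hq0, ← rpw_add hq0, ← rpw_add hq0, ← rpw_add hq0]
      exact one_sub_rpw_ne_zero hq0 hq1 (by linarith))
    (by
      rw [hpow, ← rpw_one q, ← rpw_add hq0, ← rpw_add hq0, ← rpw_add hq0]
      exact one_sub_rpw_ne_zero hq0 hq1 (by linarith))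
    (2 * x * rpw q (1 / 2))
  have hsq : rpw q 2 = (q : ℂ) ^ 2 := by exact_mod_cast rpw_natCast q 2
  have hcancel : (1 - rpw q α / rpw q β) * rpw q β = rpw q β - rpw q α := by
    rw [sub_mul, one_mul, div_mul_cancel₀ _ hβ0]
  simp only [Nat.add_sub_cancel, qJacobi_eq_jacobiPoly hq0]
  simp only [hsub, rpw_add hq0, rpw_two_mul hq0, rpw_one, hrN, hsq]
  convert h using 1
  · ring
  · congr 1
    · congr 1
      · rw [shiftCoeff₁]
        ring_nf
      · rw [shiftCoeff₂, ← hcancel]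
        ring_nf
    · rw [shiftCoeff₃]
      ring_nf
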